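/- Let d ≥ 2 be an even integer, let a, e be indeterminates, and let n be a positive integer with n ≡ d+1 (mod 2d). Then the following identity of rational functions in q, a, e holds: Σ_{k=0}^{(dn−n+1)/(2d)} (1−q^{3dk−1−dn+n}) (q^{−1−dn+n},e,q^{d−1−dn+n}/e; q^{2d})_k (aq,q/a,q^{d−3−dn+n}; q^d)_k / ((1−q^{−1−dn+n}) (q^d,e,q^{d−1−dn+n}/e; q^d)_k (aq^{2d−2−dn+n},q^{2d−2−dn+n}/a,q^{d+2}; q^{2d})_k) · q^{dk} = 0. -/

import Mathlib

open Finset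

noncomputable section

abbrev R3 : Type := MvPolynomial (Fin 3) ℚ
abbrev K3 : Type := FractionRing R3

/-- The variable `q` as a rational function in `ℚ(q,a,e)`. -/
def qv : K3 := algebraMap R3 K3 (MvPolynomial.X 0)

/-- The indeterminate `a` as a rational function in `ℚ(q,a,e)`. -/
def av : K3 := algebraMap R3 K3 (MvPolynomial.X 1)

/-- The indeterminate `e` as a rational function in `ℚ(q,a,e)`. -/
def ev : K3 := algebraMap R3 K3 (MvPolynomial.X 2)

/-- The q-shifted factorial `(a; q)_k = (1-a)(1-aq)⋯(1-aq^{k-1})`. -/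
def qPoch {R : Type*} [CommRing R] (a q : R) (k : ℕ) : R :=
  ∏ j ∈ Finset.range k, (1 - a * q ^ j)

theorem qPoch_succ {R : Type*} [CommRing R] (a q : R) (k : ℕ) :
    qPoch a q (k + 1) = qPoch a q k * (1 - a * q ^ k) :=
  prod_range_succ _ _

theorem qPoch_mul_base {R : Type*} [CommRing R] (a q : R) (k : ℕ) :
    (1 - a) * qPoch (a * q) q k = qPoch a q k * (1 - a * q ^ k) := by
  rw [← qPoch_succ, qPoch, qPoch, prod_range_succ', mul_comm]
  simp only [pow_zero, mul_one, pow_succ', mul_assoc]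

theorem qPoch_ne_zero {K : Type*} [Field K] {a q : K} {k : ℕ}
    (h : ∀ j < k, a * q ^ j ≠ 1) : qPoch a q k ≠ 0 :=
  prod_ne_zero_iff.2 fun j hj => sub_ne_zero.2 (h j (mem_range.1 hj)).symm

section Quadratic

variable {K : Type*} [Field K]

/-- The quotient `(x; p²)_k / (x; p)_k`. -/
def baseRatio (p x : K) (k : ℕ) : K :=
  qPoch x (p ^ 2) k / qPoch x p k

/-- The part of the summand of the quadratic sum that depends on neither the free parameter `e`
nor the very-well-poised factor. -/
def fixedRatio (p A b c : K) (k : ℕ) : K :=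
  qPoch A (p ^ 2) k * (qPoch b p k * qPoch c p k * qPoch (A * p / (b * c)) p k) /
    (qPoch p p k * (qPoch (A * p ^ 2 / b) (p ^ 2) k * qPoch (A * p ^ 2 / c) (p ^ 2) k *
      qPoch (b * c * p) (p ^ 2) k))

/-- The summand of the quadratic sum. -/
def quadTerm (p A b c e : K) (k : ℕ) : K :=
  (1 - A * p ^ (3 * k)) * p ^ k * fixedRatio p A b c k *
    (baseRatio p e k * baseRatio p (A * p / e) k)

/-- The antidifference certifying the contiguous relation in `e`. -/
def quadCert (p A b c e : K) (k : ℕ) : K :=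
  e * (A - p * e ^ 2) * (1 - p * e) * fixedRatio p A b c k *
    (baseRatio p e k * baseRatio p (A * p / e) k) *
    ((1 - p ^ k) * (1 - A / b * (p ^ k) ^ 2) * (1 - A / c * (p ^ k) ^ 2) *
      (1 - b * c / p * (p ^ k) ^ 2) * (1 - A / e * p ^ k) /
      ((1 - e * p ^ k) * (1 - A / (e * p) * (p ^ k) ^ 2)))

theorem baseRatio_succ (p x : K) (k : ℕ) :
    baseRatio p x (k + 1) =
      baseRatio p x k * ((1 - x * (p ^ k) ^ 2) / (1 - x * p ^ k)) := by
  have hpow : (p ^ 2) ^ k = (p ^ k) ^ 2 := by ring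
  simp only [baseRatio, qPoch_succ, hpow]
  rw [div_mul_div_comm]

theorem baseRatio_shift {p x : K} (hx : ∀ n : ℕ, x * p ^ n ≠ 1) (k : ℕ) :
    baseRatio p (x * p ^ 2) k * ((1 - x * p ^ k) * (1 - x * p * p ^ k)) =
      baseRatio p x k * ((1 - x * (p ^ k) ^ 2) * (1 - x * p)) := by
  have hx0 : 1 - x ≠ 0 := sub_ne_zero.2 (by simpa using (hx 0).symm)
  have hpow : (p ^ 2) ^ k = (p ^ k) ^ 2 := by ring
  have hnum := qPoch_mul_base x (p ^ 2) k
  have hden := qPoch_mul_base x p k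
  have hden' := qPoch_mul_base (x * p) p k
  rw [mul_assoc x p p, ← sq] at hden'
  rw [hpow] at hnum
  have h1 : qPoch x p k ≠ 0 := qPoch_ne_zero fun j _ => hx j
  have h2 : qPoch (x * p ^ 2) p k ≠ 0 := qPoch_ne_zero fun j _ => by
    rw [mul_assoc, ← pow_add]
    exact hx _
  rw [baseRatio, baseRatio, div_mul_eq_mul_div, div_mul_eq_mul_div, div_eq_div_iff h2 h1]
  refine mul_left_cancel₀ hx0 ?_
  linear_combination (qPoch x p k * (1 - x * p ^ k) * (1 - x * p * p ^ k)) * hnum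
    - qPoch x (p ^ 2) k * (1 - x * (p ^ k) ^ 2) * (1 - x) * hden'
    - qPoch x (p ^ 2) k * (1 - x * (p ^ k) ^ 2) * (1 - x * p * p ^ k) * hden

theorem fixedRatio_succ (p A b c : K) (k : ℕ) :
    fixedRatio p A b c (k + 1) = fixedRatio p A b c k *
      ((1 - A * (p ^ k) ^ 2) * (1 - b * p ^ k) * (1 - c * p ^ k) *
        (1 - A * p / (b * c) * p ^ k) /
        ((1 - p * p ^ k) * (1 - A * p ^ 2 / b * (p ^ k) ^ 2) *
          (1 - A * p ^ 2 / c * (p ^ k) ^ 2) * (1 - b * c * p * (p ^ k) ^ 2))) := by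
  have r3 : (p ^ 2) ^ k = (p ^ k) ^ 2 := by ring
  simp only [fixedRatio, qPoch_succ, r3]
  rw [div_mul_div_comm]
  congr 1 <;> ring

theorem contiguous_core {p b c g e : K} (hp : p ≠ 0) (he0 : e ≠ 0) (z : K) :
    (e - c * g) * (e - b * g) * (b * c - p * e) * (1 - b * c * g * z ^ 3) * z * (1 - e * z) *
        (1 - e * p * z) * (1 - b * c * g / (e * p) * z ^ 2) -
      e * (p * e - b) * (p * e - c) * (e - g) * (1 - b * c * g * z ^ 3) * z * (1 - e * z ^ 2) *
        (1 - b * c * g / (e * p) * z) * (1 - b * c * g / e * z) =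
    e * (b * c * g - p * e ^ 2) *
      ((1 - b * c * g * z ^ 2) * (1 - e * z ^ 2) * (1 - b * z) * (1 - c * z) * (1 - g * p * z) *
          (1 - b * c * g / (e * p) * z ^ 2) -
        (1 - z) * (1 - c * g * z ^ 2) * (1 - b * g * z ^ 2) * (1 - b * c / p * z ^ 2) *
          (1 - b * c * g / e * z) * (1 - e * p * z)) := by
  field_simp
  ring

theorem quadTerm_shift {p A b c e : K} (hp : p ≠ 0) (he0 : e ≠ 0)
    (he : ∀ n : ℕ, e * p ^ n ≠ 1) (he' : ∀ n : ℕ, A / (e * p) * p ^ n ≠ 1) (k : ℕ) :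
    quadTerm p A b c (e * p ^ 2) k * ((1 - e * p ^ k) * (1 - e * p * p ^ k) *
      (1 - A / (e * p) * (p ^ k) ^ 2) * (e - A)) =
    (1 - A * p ^ (3 * k)) * p ^ k * fixedRatio p A b c k *
      (baseRatio p e k * baseRatio p (A * p / e) k) *
      (e * (1 - e * (p ^ k) ^ 2) * (1 - e * p) * (1 - A / (e * p) * p ^ k) *
        (1 - A / e * p ^ k)) := by
  have shift := baseRatio_shift he k
  have shift' := baseRatio_shift he' k
  have e1 : A / (e * p) * p ^ 2 = A * p / e := by field_simp
  have e2 : A / (e * p) * p = A / e := by field_simp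
  have e3 : A * p / (e * p ^ 2) = A / (e * p) := by field_simp
  have e4 : e - A = e * (1 - A / e) := by field_simp
  rw [e1, e2] at shift'
  rw [quadTerm, e3, e4]
  linear_combination (1 - A * p ^ (3 * k)) * p ^ k * fixedRatio p A b c k * e *
    ((1 - A / (e * p) * (p ^ k) ^ 2) * (1 - A / e) * baseRatio p (A / (e * p)) k * shift -
      baseRatio p e k * (1 - e * (p ^ k) ^ 2) * (1 - e * p) * shift')

theorem cancel_step_factors {w₁ w₂ w₃ w₄ w₅ w₆ w₇ w₈ : K} (h₁ : w₁ ≠ 0) (h₂ : w₂ ≠ 0)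
    (h₃ : w₃ ≠ 0) (h₄ : w₄ ≠ 0) (h₅ : w₅ ≠ 0) (h₆ : w₆ ≠ 0) (h₇ : w₇ ≠ 0) (h₈ : w₈ ≠ 0)
    (κ F N u v x : K) :
    κ * (F * (N / (w₁ * w₂ * w₃ * w₄))) * (u * (x / w₅) * (v * (w₈ / w₇))) *
      (w₁ * w₂ * w₃ * w₄ * w₇ / (w₆ * w₈)) * (w₅ * w₆) = κ * F * (u * v) * (N * x) := by
  field_simp

theorem quadCert_succ {p A b c e : K} (hp : p ≠ 0) (hb0 : b ≠ 0) (hc0 : c ≠ 0) (he0 : e ≠ 0)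
    (hp1 : ∀ n : ℕ, p * p ^ n ≠ 1) (hb : ∀ n : ℕ, A * p ^ 2 / b * p ^ n ≠ 1)
    (hc : ∀ n : ℕ, A * p ^ 2 / c * p ^ n ≠ 1) (hbc : ∀ n : ℕ, b * c * p * p ^ n ≠ 1)
    (he : ∀ n : ℕ, e * p ^ n ≠ 1) (he' : ∀ n : ℕ, A / (e * p) * p ^ n ≠ 1) (k : ℕ) :
    quadCert p A b c e (k + 1) * ((1 - e * p ^ k) * (1 - e * p * p ^ k)) =
      e * (A - p * e ^ 2) * (1 - p * e) * fixedRatio p A b c k *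
        (baseRatio p e k * baseRatio p (A * p / e) k) *
        ((1 - A * (p ^ k) ^ 2) * (1 - e * (p ^ k) ^ 2) * (1 - b * p ^ k) * (1 - c * p ^ k) *
          (1 - A / (b * c) * p * p ^ k)) := by
  have s : ∀ x y : K, x ≠ 1 → x = y → 1 - y ≠ 0 := fun x y hx h => sub_ne_zero.2 (h ▸ hx.symm)
  rw [quadCert, baseRatio_succ, baseRatio_succ, fixedRatio_succ]
  have u1 := s _ _ (hp1 k) rfl
  have u2 : 1 - A * p ^ 2 / b * (p ^ k) ^ 2 ≠ 0 := s _ _ (hb (k * 2)) (by rw [pow_mul])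
  have u3 : 1 - A * p ^ 2 / c * (p ^ k) ^ 2 ≠ 0 := s _ _ (hc (k * 2)) (by rw [pow_mul])
  have u4 : 1 - b * c * p * (p ^ k) ^ 2 ≠ 0 := s _ _ (hbc (k * 2)) (by rw [pow_mul])
  have u5 := s _ _ (he k) rfl
  have u6 : 1 - e * p * p ^ k ≠ 0 := s _ _ (he (k + 1)) (by ring)
  have u7 : 1 - A * p / e * p ^ k ≠ 0 := s _ _ (he' (k + 2)) (by field_simp; ring)
  have u8 : 1 - A * p / e * (p ^ k) ^ 2 ≠ 0 := s _ _ (he' (k * 2 + 2)) (by field_simp; ring)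
  have e1 : A / b * (p ^ (k + 1)) ^ 2 = A * p ^ 2 / b * (p ^ k) ^ 2 := by ring
  have e2 : A / c * (p ^ (k + 1)) ^ 2 = A * p ^ 2 / c * (p ^ k) ^ 2 := by ring
  have e3 : b * c / p * (p ^ (k + 1)) ^ 2 = b * c * p * (p ^ k) ^ 2 := by field_simp; ring
  have e4 : A / e * p ^ (k + 1) = A * p / e * p ^ k := by ring
  have e5 : e * p ^ (k + 1) = e * p * p ^ k := by ring
  have e6 : A / (e * p) * (p ^ (k + 1)) ^ 2 = A * p / e * (p ^ k) ^ 2 := by field_simp; ring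
  have e7 : A * p / (b * c) = A / (b * c) * p := by ring
  rw [e1, e2, e3, e4, e5, e6, e7, pow_succ' p k]
  rw [cancel_step_factors u1 u2 u3 u4 u5 u6 u7 u8]
  ring

theorem quadTerm_contiguous {p A b c e : K} (hp : p ≠ 0) (hb0 : b ≠ 0) (hc0 : c ≠ 0) (he0 : e ≠ 0)
    (hp1 : ∀ n : ℕ, p * p ^ n ≠ 1) (hb : ∀ n : ℕ, A * p ^ 2 / b * p ^ n ≠ 1)
    (hc : ∀ n : ℕ, A * p ^ 2 / c * p ^ n ≠ 1) (hbc : ∀ n : ℕ, b * c * p * p ^ n ≠ 1)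
    (he : ∀ n : ℕ, e * p ^ n ≠ 1) (he' : ∀ n : ℕ, A / (e * p) * p ^ n ≠ 1) (k : ℕ) :
    (e - A / b) * (e - A / c) * (b * c - p * e) * (1 - p * e) * quadTerm p A b c e k -
      (e - A) * (p * e - b) * (p * e - c) * (e - A / (b * c)) * quadTerm p A b c (e * p ^ 2) k =
    quadCert p A b c e (k + 1) - quadCert p A b c e k := by
  have hshift := quadTerm_shift (b := b) (c := c) hp he0 he he' k
  have hsucc := quadCert_succ hp hb0 hc0 he0 hp1 hb hc hbc he he' k
  have s : ∀ x y : K, x ≠ 1 → x = y → 1 - y ≠ 0 := fun x y hx h => sub_ne_zero.2 (h ▸ hx.symm)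
  have u1 := s _ _ (he k) rfl
  have u2 : 1 - e * p * p ^ k ≠ 0 := s _ _ (he (k + 1)) (by ring)
  have u3 : 1 - A / (e * p) * (p ^ k) ^ 2 ≠ 0 := s _ _ (he' (k * 2)) (by rw [pow_mul])
  have hcert : quadCert p A b c e k * ((1 - e * p ^ k) * (1 - A / (e * p) * (p ^ k) ^ 2)) =
      e * (A - p * e ^ 2) * (1 - p * e) * fixedRatio p A b c k *
      (baseRatio p e k * baseRatio p (A * p / e) k) *
      ((1 - p ^ k) * (1 - A / b * (p ^ k) ^ 2) * (1 - A / c * (p ^ k) ^ 2) *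
        (1 - b * c / p * (p ^ k) ^ 2) * (1 - A / e * p ^ k)) := by
    rw [quadCert, mul_assoc, div_mul_cancel₀ _ (mul_ne_zero u1 u3)]
  have hterm : quadTerm p A b c e k = (1 - A * (p ^ k) ^ 3) * p ^ k * fixedRatio p A b c k *
      (baseRatio p e k * baseRatio p (A * p / e) k) := by
    rw [quadTerm, mul_comm 3 k, pow_mul]
  rw [mul_comm 3 k, pow_mul] at hshift
  have core := contiguous_core (b := b) (c := c) (g := A / (b * c)) hp he0 (p ^ k)
  have e1 : b * c * (A / (b * c)) = A := by field_simp
  have e2 : c * (A / (b * c)) = A / b := by field_simp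
  have e3 : b * (A / (b * c)) = A / c := by field_simp
  rw [e1, e2, e3] at core
  refine mul_right_cancel₀ (mul_ne_zero (mul_ne_zero u1 u2) u3) ?_
  rw [hterm]
  linear_combination (-((p * e - b) * (p * e - c) * (e - A / (b * c)))) * hshift
    - (1 - A / (e * p) * (p ^ k) ^ 2) * hsucc + (1 - e * p * p ^ k) * hcert
    + fixedRatio p A b c k * (baseRatio p e k * baseRatio p (A * p / e) k) * (1 - p * e) * core

theorem quadTerm_sum_contiguous {p A b c e : K} (hp : p ≠ 0) (hb0 : b ≠ 0) (hc0 : c ≠ 0)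
    (he0 : e ≠ 0) (hp1 : ∀ n : ℕ, p * p ^ n ≠ 1) (hb : ∀ n : ℕ, A * p ^ 2 / b * p ^ n ≠ 1)
    (hc : ∀ n : ℕ, A * p ^ 2 / c * p ^ n ≠ 1) (hbc : ∀ n : ℕ, b * c * p * p ^ n ≠ 1)
    (he : ∀ n : ℕ, e * p ^ n ≠ 1) (he' : ∀ n : ℕ, A / (e * p) * p ^ n ≠ 1) {M : ℕ}
    (hA : A * p ^ (2 * M) = 1) :
    (e - A / b) * (e - A / c) * (b * c - p * e) * (1 - p * e) *
        ∑ k ∈ range (M + 1), quadTerm p A b c e k =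
      (e - A) * (p * e - b) * (p * e - c) * (e - A / (b * c)) *
        ∑ k ∈ range (M + 1), quadTerm p A b c (e * p ^ 2) k := by
  rw [← sub_eq_zero, mul_sum, mul_sum, ← sum_sub_distrib,
    sum_congr rfl fun k _ => quadTerm_contiguous hp hb0 hc0 he0 hp1 hb hc hbc he he' k,
    sum_range_sub]
  have hpoch : qPoch A (p ^ 2) (M + 1) = 0 := by
    rw [qPoch_succ, ← pow_mul, hA, sub_self, mul_zero]
  simp [quadCert, fixedRatio, hpoch]

theorem quadTerm_swap (p A b c e : K) (k : ℕ) : quadTerm p A c b e k = quadTerm p A b c e k := by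
  simp only [quadTerm, fixedRatio, mul_comm c b]
  congr 3 <;> ring

/-- The polynomial in `X = e` obtained from the quadratic sum by clearing the denominators
that depend on `e`. -/
def quadPoly (p A b c : K) (M : ℕ) : Polynomial K :=
  ∑ k ∈ range (M + 1), Polynomial.C ((1 - A * p ^ (3 * k)) * p ^ k * fixedRatio p A b c k) *
    (((∏ j ∈ range k, (1 - Polynomial.X * Polynomial.C ((p ^ 2) ^ j))) *
      ∏ j ∈ Ico k M, (1 - Polynomial.X * Polynomial.C (p ^ j))) *
    ((∏ j ∈ range k, (Polynomial.X - Polynomial.C (A * p * (p ^ 2) ^ j))) *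
      ∏ j ∈ Ico k M, (Polynomial.X - Polynomial.C (A * p * p ^ j))))

theorem eval_quadPoly {p A b c e : K} (he0 : e ≠ 0) (he : ∀ n : ℕ, e * p ^ n ≠ 1)
    (he' : ∀ n : ℕ, A * p / e * p ^ n ≠ 1) (M : ℕ) :
    (quadPoly p A b c M).eval e =
      (qPoch e p M * (e ^ M * qPoch (A * p / e) p M)) *
        ∑ k ∈ range (M + 1), quadTerm p A b c e k := by
  rw [quadPoly, Polynomial.eval_finsetSum, mul_sum]
  refine sum_congr rfl fun k hk => ?_
  have hkM : k ≤ M := Nat.lt_succ_iff.1 (mem_range.1 hk)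
  have hfac : ∀ y : K, e - A * p * y = e * (1 - A * p / e * y) := fun y => by field_simp
  have hsplit : ∀ x : K, qPoch x p M = qPoch x p k * ∏ j ∈ Ico k M, (1 - x * p ^ j) :=
    fun x => (prod_range_mul_prod_Ico _ hkM).symm
  have hpow : e ^ M = e ^ k * e ^ (M - k) := by rw [← pow_add, Nat.add_sub_cancel' hkM]
  have h1 : qPoch e p k ≠ 0 := qPoch_ne_zero fun j _ => he j
  have h2 : qPoch (A * p / e) p k ≠ 0 := qPoch_ne_zero fun j _ => he' j
  simp only [Polynomial.eval_mul, Polynomial.eval_prod, Polynomial.eval_sub, Polynomial.eval_one,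
    Polynomial.eval_X, Polynomial.eval_C, hfac, prod_mul_distrib, prod_const, card_range,
    Nat.card_Ico, quadTerm, baseRatio]
  rw [hsplit e, hsplit (A * p / e), hpow]
  simp only [qPoch] at h1 h2 ⊢
  generalize A * p / e = h at h2 ⊢
  field_simp

theorem natDegree_quadPoly_le (p A b c : K) (M : ℕ) : (quadPoly p A b c M).natDegree ≤ 2 * M := by
  refine Polynomial.natDegree_sum_le_of_forall_le _ _ fun k hk => ?_
  have hkM : k ≤ M := Nat.lt_succ_iff.1 (mem_range.1 hk)
  have hprod : ∀ (s : Finset ℕ) (f : ℕ → Polynomial K), (∀ j, (f j).natDegree ≤ 1) →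
      (∏ j ∈ s, f j).natDegree ≤ s.card := fun s f hf =>
    (Polynomial.natDegree_prod_le _ _).trans
      ((sum_le_card_nsmul _ _ 1 fun j _ => hf j).trans_eq (by simp))
  have h1 : ∀ y : K, (1 - Polynomial.X * Polynomial.C y : Polynomial K).natDegree ≤ 1 :=
    fun y => by compute_degree
  have h2 : ∀ y : K, (Polynomial.X - Polynomial.C y : Polynomial K).natDegree ≤ 1 :=
    fun y => by compute_degree
  refine (Polynomial.natDegree_C_mul_le _ _).trans ?_
  have key := Polynomial.natDegree_mul_le_of_le
    (Polynomial.natDegree_mul_le_of_le (hprod (range k) _ fun j => h1 ((p ^ 2) ^ j))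
      (hprod (Ico k M) _ fun j => h1 (p ^ j)))
    (Polynomial.natDegree_mul_le_of_le (hprod (range k) _ fun j => h2 (A * p * (p ^ 2) ^ j))
      (hprod (Ico k M) _ fun j => h2 (A * p * p ^ j)))
  refine key.trans ?_
  simp only [card_range, Nat.card_Ico]
  omega

theorem eval_one_quadPoly (p A b c : K) {M : ℕ} (hM : 0 < M) :
    (quadPoly p A b c M).eval 1 = 0 := by
  rw [quadPoly, Polynomial.eval_finsetSum]
  refine sum_eq_zero fun k _ => ?_
  simp only [Polynomial.eval_mul, Polynomial.eval_prod, Polynomial.eval_sub, Polynomial.eval_one,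
    Polynomial.eval_X, Polynomial.eval_C]
  rcases Nat.eq_zero_or_pos k with rfl | hk
  · rw [prod_eq_zero (s := Ico 0 M) (i := 0) (by simpa using hM) (by simp)]
    ring
  · rw [prod_eq_zero (s := range k) (i := 0) (by simpa using hk) (by simp)]
    ring

theorem mul_zpow_ne_zpow {p x : K} (hp : p ≠ 0) (hx : ∀ n : ℤ, x ≠ p ^ n) (m n : ℤ) :
    x * p ^ m ≠ p ^ n := fun h =>
  hx (n - m) (by rw [zpow_sub₀ hp, eq_div_iff (zpow_ne_zero _ hp), h])

theorem mul_pow_ne_one_of_ne_zpow {p x : K} (hp : p ≠ 0) (hx : ∀ n : ℤ, x ≠ p ^ n) (n : ℕ) :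
    x * p ^ n ≠ 1 := by
  simpa using mul_zpow_ne_zpow hp hx n 0

theorem zpow_div_ne_zpow {p x : K} (hp : p ≠ 0) (hx0 : x ≠ 0) (hx : ∀ n : ℤ, x ≠ p ^ n)
    (m n : ℤ) : p ^ m / x ≠ p ^ n := fun h =>
  mul_zpow_ne_zpow hp hx n m (by rw [← h]; field_simp)

theorem mul_zpow_ne_zpow_of_sq {p x : K} (hp : p ≠ 0) (hx0 : x ≠ 0) (hx : ∀ n : ℤ, x ^ 2 ≠ p ^ n)
    (m n : ℤ) : x * p ^ m ≠ p ^ n / x := fun h =>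
  mul_zpow_ne_zpow hp hx m n (by
    rw [eq_div_iff hx0] at h
    rw [← h]
    ring)

/-- One step of the descent through the zeros `b p⁻¹, b p⁻³, …, b p^(1-2M)` of the terminating
quadratic sum. -/
theorem quadTerm_sum_eq_zero_descent {p b c : K} {M : ℕ} (hp : p ≠ 0)
    (hp1 : ∀ n : ℕ, p * p ^ n ≠ 1) (hb0 : b ≠ 0) (hc0 : c ≠ 0) (hb : ∀ n : ℤ, b ≠ p ^ n)
    (hc : ∀ n : ℤ, c ≠ p ^ n) (hbb : ∀ n : ℤ, b ^ 2 ≠ p ^ n)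
    (hbc : ∀ n : ℕ, b * c * p * p ^ n ≠ 1) {j : ℕ} (hj : j < M)
    (hprev : (b * p ^ (-2 * j : ℤ) - b) * ∑ k ∈ range (M + 1),
      quadTerm p (p ^ (-2 * M : ℤ)) b c (b * p ^ (1 - 2 * j : ℤ)) k = 0) :
    ∑ k ∈ range (M + 1), quadTerm p (p ^ (-2 * M : ℤ)) b c (b * p ^ (-1 - 2 * j : ℤ)) k = 0 := by
  have hz : ∀ m : ℤ, p ^ m ≠ 0 := fun m => zpow_ne_zero m hp
  have hA : p ^ (-2 * M : ℤ) * p ^ (2 * M) = 1 := by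
    rw [← zpow_natCast, ← zpow_add₀ hp]
    simp
  have hA2 : p ^ (-2 * M : ℤ) * p ^ 2 = p ^ (-2 * M + 2 : ℤ) := by
    rw [zpow_add₀ hp]
    norm_cast
  have hpe : p * (b * p ^ (-1 - 2 * j : ℤ)) = b * p ^ (-2 * j : ℤ) := by
    rw [show (-2 * j : ℤ) = 1 + (-1 - 2 * j) by ring, zpow_add₀ hp 1, zpow_one]
    ring
  have hEz : ∀ n : ℤ, b * p ^ (-1 - 2 * j : ℤ) ≠ p ^ n := mul_zpow_ne_zpow hp hb _
  have hcont := quadTerm_sum_contiguous (A := p ^ (-2 * M : ℤ)) (b := b) (c := c)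
    (e := b * p ^ (-1 - 2 * j : ℤ)) hp hb0 hc0 (mul_ne_zero hb0 (hz _)) hp1
    (fun n => by
      rw [hA2]
      exact mul_pow_ne_one_of_ne_zpow hp (zpow_div_ne_zpow hp hb0 hb _) n)
    (fun n => by
      rw [hA2]
      exact mul_pow_ne_one_of_ne_zpow hp (zpow_div_ne_zpow hp hc0 hc _) n)
    hbc (mul_pow_ne_one_of_ne_zpow hp hEz)
    (fun n => by
      rw [mul_comm _ p, hpe]
      exact mul_pow_ne_one_of_ne_zpow hp
        (zpow_div_ne_zpow hp (mul_ne_zero hb0 (hz _)) (mul_zpow_ne_zpow hp hb _) _) n) hA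
  have hcoef : (b * p ^ (-1 - 2 * j : ℤ) - p ^ (-2 * M : ℤ) / b) *
      (b * p ^ (-1 - 2 * j : ℤ) - p ^ (-2 * M : ℤ) / c) *
      (b * c - p * (b * p ^ (-1 - 2 * j : ℤ))) * (1 - p * (b * p ^ (-1 - 2 * j : ℤ))) ≠ 0 := by
    refine mul_ne_zero (mul_ne_zero (mul_ne_zero ?_ ?_) ?_) ?_
    · exact sub_ne_zero.2 (mul_zpow_ne_zpow_of_sq hp hb0 hbb _ _)
    · refine sub_ne_zero.2 fun h => hbc (2 * M - 2 - 2 * j) ?_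
      rw [eq_div_iff hc0] at h
      have hexp : p * p ^ (2 * M - 2 - 2 * j) = p ^ (-1 - 2 * j : ℤ) * p ^ (2 * M) := by
        rw [← pow_succ', ← zpow_natCast, ← zpow_natCast p (2 * M), ← zpow_add₀ hp]
        congr 1
        omega
      rw [mul_assoc, hexp, ← hA, ← h]
      ring
    · rw [hpe, ← mul_sub]
      exact mul_ne_zero hb0 (sub_ne_zero.2 (hc _))
    · rw [hpe]
      exact sub_ne_zero.2 (by simpa using (mul_zpow_ne_zpow hp hb (-2 * j) 0).symm)
  refine (mul_eq_zero.1 (hcont.trans ?_)).resolve_left hcoef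
  have hep : b * p ^ (-1 - 2 * j : ℤ) * p ^ 2 = b * p ^ (1 - 2 * j : ℤ) := by
    rw [show (1 - 2 * j : ℤ) = -1 - 2 * j + 2 by ring, zpow_add₀ hp _ 2, mul_assoc]
    norm_cast
  rw [hep, hpe]
  linear_combination (b * p ^ (-1 - 2 * j : ℤ) - p ^ (-2 * M : ℤ)) * (b * p ^ (-2 * j : ℤ) - c) *
    (b * p ^ (-1 - 2 * j : ℤ) - p ^ (-2 * M : ℤ) / (b * c)) * hprev

/-- The terminating quadratic sum vanishes at the points `b p⁻¹, b p⁻³, …, b p^(1-2M)`. -/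
theorem quadTerm_sum_eq_zero_of_chain {p b c : K} {M : ℕ} (hp : p ≠ 0)
    (hp1 : ∀ n : ℕ, p * p ^ n ≠ 1) (hb0 : b ≠ 0) (hc0 : c ≠ 0) (hb : ∀ n : ℤ, b ≠ p ^ n)
    (hc : ∀ n : ℤ, c ≠ p ^ n) (hbb : ∀ n : ℤ, b ^ 2 ≠ p ^ n)
    (hbc : ∀ n : ℕ, b * c * p * p ^ n ≠ 1) {j : ℕ} (hj : j < M) :
    ∑ k ∈ range (M + 1), quadTerm p (p ^ (-2 * M : ℤ)) b c (b * p ^ (-1 - 2 * j : ℤ)) k = 0 := by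
  refine quadTerm_sum_eq_zero_descent hp hp1 hb0 hc0 hb hc hbb hbc hj ?_
  induction j with
  | zero => simp
  | succ i ih =>
    have hi := quadTerm_sum_eq_zero_descent hp hp1 hb0 hc0 hb hc hbb hbc
      (Nat.lt_of_succ_lt hj) (ih (Nat.lt_of_succ_lt hj))
    rw [show (1 - 2 * (i + 1 : ℕ) : ℤ) = -1 - 2 * i by push_cast; ring, hi, mul_zero]

theorem mul_zpow_injective {p b : K} (hp : p ≠ 0) (hp1 : ∀ n : ℕ, p * p ^ n ≠ 1) (hb0 : b ≠ 0)
    {i j : ℕ} (h : b * p ^ (-1 - 2 * i : ℤ) = b * p ^ (-1 - 2 * j : ℤ)) : i = j := by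
  wlog hij : i < j generalizing i j
  · rcases (not_lt.1 hij).lt_or_eq with hlt | heq
    · exact (this h.symm hlt).symm
    · exact heq.symm
  refine absurd ?_ (hp1 (2 * j - 2 * i - 1))
  rw [← pow_succ', ← zpow_natCast, show ((2 * j - 2 * i - 1 + 1 : ℕ) : ℤ) =
    (-1 - 2 * i) - (-1 - 2 * j) by omega, zpow_sub₀ hp, mul_left_cancel₀ hb0 h,
    div_self (zpow_ne_zero _ hp)]

/-- The terminating quadratic summation, for generic parameters. -/
theorem quadTerm_sum_eq_zero {p b c e : K} {M : ℕ} (hM : 0 < M) (hp : p ≠ 0)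
    (hp1 : ∀ n : ℕ, p * p ^ n ≠ 1) (hb0 : b ≠ 0) (hc0 : c ≠ 0) (he0 : e ≠ 0)
    (hb : ∀ n : ℤ, b ≠ p ^ n) (hc : ∀ n : ℤ, c ≠ p ^ n) (he : ∀ n : ℤ, e ≠ p ^ n)
    (hbb : ∀ n : ℤ, b ^ 2 ≠ p ^ n) (hcc : ∀ n : ℤ, c ^ 2 ≠ p ^ n)
    (hb_div_c : ∀ n : ℤ, b / c ≠ p ^ n) (hbc : ∀ n : ℕ, b * c * p * p ^ n ≠ 1) :
    ∑ k ∈ range (M + 1), quadTerm p (p ^ (-2 * M : ℤ)) b c e k = 0 := by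
  have hz : ∀ m : ℤ, p ^ m ≠ 0 := fun m => zpow_ne_zero m hp
  have hAp : p ^ (-2 * M : ℤ) * p = p ^ (-2 * M + 1 : ℤ) := by rw [zpow_add₀ hp, zpow_one]
  have heval : ∀ x : K, x ≠ 0 → (∀ n : ℤ, x ≠ p ^ n) →
      (quadPoly p (p ^ (-2 * M : ℤ)) b c M).eval x =
        (qPoch x p M * (x ^ M * qPoch (p ^ (-2 * M : ℤ) * p / x) p M)) *
          ∑ k ∈ range (M + 1), quadTerm p (p ^ (-2 * M : ℤ)) b c x k := fun x hx0 hx =>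
    eval_quadPoly hx0 (mul_pow_ne_one_of_ne_zpow hp hx) (fun n => by
      rw [hAp]
      exact mul_pow_ne_one_of_ne_zpow hp (zpow_div_ne_zpow hp hx0 hx _) n) M
  have hzero : quadPoly p (p ^ (-2 * M : ℤ)) b c M = 0 := by
    refine Polynomial.eq_zero_of_natDegree_lt_card_of_eval_eq_zero _
      (f := fun i : Option (Fin M ⊕ Fin M) => i.elim 1 (Sum.elim
        (fun j => b * p ^ (-1 - 2 * (j : ℕ) : ℤ)) (fun j => c * p ^ (-1 - 2 * (j : ℕ) : ℤ))))
      ?_ ?_ ?_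
    · have hne : ∀ x : K, (∀ n : ℤ, x ≠ p ^ n) → ∀ m : ℤ, x * p ^ m ≠ 1 := fun x hx m => by
        simpa using mul_zpow_ne_zpow hp hx m 0
      have hbc_ne : ∀ m n : ℤ, b * p ^ m ≠ c * p ^ n := fun m n h =>
        mul_zpow_ne_zpow hp hb_div_c m n (by
          rw [div_mul_eq_mul_div, h, mul_div_cancel_left₀ _ hc0])
      rintro (_ | i | i) (_ | j | j) h
      · rfl
      · exact absurd h.symm (hne b hb _)
      · exact absurd h.symm (hne c hc _)
      · exact absurd h (hne b hb _)
      · exact congrArg _ (congrArg _ (Fin.ext (mul_zpow_injective hp hp1 hb0 h)))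
      · exact absurd h (hbc_ne _ _)
      · exact absurd h (hne c hc _)
      · exact absurd h.symm (hbc_ne _ _)
      · exact congrArg _ (congrArg _ (Fin.ext (mul_zpow_injective hp hp1 hc0 h)))
    · rintro (_ | j | j)
      · exact eval_one_quadPoly p _ b c hM
      · refine (heval _ (mul_ne_zero hb0 (hz _)) (mul_zpow_ne_zpow hp hb _)).trans ?_
        rw [quadTerm_sum_eq_zero_of_chain hp hp1 hb0 hc0 hb hc hbb hbc j.2, mul_zero]
      · refine (heval _ (mul_ne_zero hc0 (hz _)) (mul_zpow_ne_zpow hp hc _)).trans ?_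
        rw [sum_congr rfl fun k _ => (quadTerm_swap p _ b c _ k).symm,
          quadTerm_sum_eq_zero_of_chain hp hp1 hc0 hb0 hc hb hcc
            (fun n => by rw [mul_comm c b]; exact hbc n) j.2, mul_zero]
    · refine (natDegree_quadPoly_le _ _ _ _ _).trans_lt ?_
      simp only [Fintype.card_option, Fintype.card_sum, Fintype.card_fin]
      omega
  have hpoch : ∀ x : K, (∀ n : ℤ, x ≠ p ^ n) → qPoch x p M ≠ 0 := fun x hx =>
    qPoch_ne_zero fun j _ => mul_pow_ne_one_of_ne_zpow hp hx j
  have hfin := heval e he0 he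
  rw [hzero, Polynomial.eval_zero, eq_comm] at hfin
  refine (mul_eq_zero.1 hfin).resolve_left (mul_ne_zero (hpoch e he)
    (mul_ne_zero (pow_ne_zero _ he0) (hpoch _ ?_)))
  rw [hAp]
  exact zpow_div_ne_zpow hp he0 he _

end Quadratic

theorem qv_ne_zero : qv ≠ 0 := by
  simp [qv]

theorem av_ne_zero : av ≠ 0 := by
  simp [av]

theorem ev_ne_zero : ev ≠ 0 := by
  simp [ev]

theorem pow_exponents_injective {i j k l m n : ℕ}
    (h : qv ^ i * av ^ j * ev ^ k = qv ^ l * av ^ m * ev ^ n) : i = l ∧ j = m ∧ k = n := by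
  simp only [qv, av, ev, ← map_pow, ← map_mul] at h
  have h' := IsFractionRing.injective R3 K3 h
  simp only [MvPolynomial.X_pow_eq_monomial, MvPolynomial.monomial_mul, mul_one] at h'
  have hm := (MvPolynomial.monomial_left_inj (one_ne_zero (α := ℚ))).1 h'
  have h0 := DFunLike.congr_fun hm 0
  have h1 := DFunLike.congr_fun hm 1
  have h2 := DFunLike.congr_fun hm 2
  simp at h0 h1 h2
  exact ⟨h0, h1, h2⟩

/-- The variables `q, a, e` are multiplicatively independent. -/
theorem zpow_mul_eq_one {i j k : ℤ} (h : qv ^ i * av ^ j * ev ^ k = 1) :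
    i = 0 ∧ j = 0 ∧ k = 0 := by
  have hsplit : ∀ {x : K3}, x ≠ 0 → ∀ n : ℤ, x ^ n * x ^ (-n).toNat = x ^ n.toNat :=
    fun {x} hx n => by
      rw [← zpow_natCast, ← zpow_natCast, ← zpow_add₀ hx]
      congr 1
      omega
  have key := pow_exponents_injective (i := i.toNat) (j := j.toNat) (k := k.toNat)
    (l := (-i).toNat) (m := (-j).toNat) (n := (-k).toNat) (by
      rw [← hsplit qv_ne_zero, ← hsplit av_ne_zero, ← hsplit ev_ne_zero]
      linear_combination qv ^ (-i).toNat * av ^ (-j).toNat * ev ^ (-k).toNat * h)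
  omega

theorem zpow_mul_ne_zpow {i j k m : ℤ} (h : j ≠ 0 ∨ k ≠ 0 ∨ i ≠ m) :
    qv ^ i * av ^ j * ev ^ k ≠ qv ^ m := fun heq => by
  have := zpow_mul_eq_one (i := i - m) (j := j) (k := k) (by
    rw [zpow_sub₀ qv_ne_zero, div_mul_eq_mul_div, div_mul_eq_mul_div, heq,
      div_self (zpow_ne_zero _ qv_ne_zero)])
  omega

/-- `n ≡ d + 1 (mod 2d)` with `d` even makes the upper summation bound exact. -/
theorem exists_summation_bound {d n : ℕ} (hd2 : 2 ≤ d) (hdeven : Even d)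
    (hmod : n % (2 * d) = (d + 1) % (2 * d)) :
    ∃ M : ℕ, 0 < M ∧ d * n - n + 1 = 2 * d * M ∧ (1 + d * n - n : ℤ) = 2 * d * M := by
  obtain ⟨r, rfl⟩ := hdeven
  rw [Nat.mod_eq_of_lt (a := r + r + 1) (by omega)] at hmod
  obtain ⟨m, hm⟩ : ∃ m, n = 2 * (r + r) * m + (r + r + 1) :=
    ⟨n / (2 * (r + r)), by rw [← hmod]; exact (Nat.div_add_mod _ _).symm⟩
  have hbound : (1 + (r + r : ℕ) * n - n : ℤ) = 2 * (r + r : ℕ) * (r + (2 * r - 1) * m : ℤ) := by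
    rw [hm]
    push_cast
    ring
  have hcast : ((r + (2 * r - 1) * m : ℕ) : ℤ) = r + (2 * r - 1) * m := by
    have : ((2 * r - 1 : ℕ) : ℤ) = 2 * r - 1 := by omega
    push_cast [this]
    ring
  refine ⟨r + (2 * r - 1) * m, by omega, ?_, by rw [hbound, hcast]⟩
  have hle : n ≤ (r + r) * n := Nat.le_mul_of_pos_left n (by omega)
  rw [← hcast] at hbound
  zify [hle]
  push_cast at hbound ⊢
  linarith

/-- Identity (3.3): for even `d ≥ 2` and `n ≡ d+1 (mod 2d)`,
`Σ_{k=0}^{(dn-n+1)/(2d)} (1-q^{3dk-1-dn+n})(q^{-1-dn+n},e,q^{d-1-dn+n}/e;q^{2d})_k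
(aq,q/a,q^{d-3-dn+n};q^d)_k /
((1-q^{-1-dn+n})(q^d,e,q^{d-1-dn+n}/e;q^d)_k
(aq^{2d-2-dn+n},q^{2d-2-dn+n}/a,q^{d+2};q^{2d})_k) · q^{dk} = 0`. -/
theorem stmt12 (d : ℕ) (hd2 : 2 ≤ d) (hdeven : Even d) (n : ℕ) (hn : 0 < n)
    (hmod : n % (2 * d) = (d + 1) % (2 * d)) :
    (∑ k ∈ Finset.range ((d * n - n + 1) / (2 * d) + 1),
      (1 - qv ^ (3 * (d : ℤ) * k - 1 - d * n + n)) *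
        (qPoch (qv ^ (-1 - (d : ℤ) * n + n)) (qv ^ (2 * d)) k * qPoch ev (qv ^ (2 * d)) k *
          qPoch (qv ^ ((d : ℤ) - 1 - d * n + n) / ev) (qv ^ (2 * d)) k) *
        (qPoch (av * qv) (qv ^ d) k * qPoch (qv / av) (qv ^ d) k *
          qPoch (qv ^ ((d : ℤ) - 3 - d * n + n)) (qv ^ d) k) /
        ((1 - qv ^ (-1 - (d : ℤ) * n + n)) *
          (qPoch (qv ^ d) (qv ^ d) k * qPoch ev (qv ^ d) k *
            qPoch (qv ^ ((d : ℤ) - 1 - d * n + n) / ev) (qv ^ d) k) *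
          (qPoch (av * qv ^ (2 * (d : ℤ) - 2 - d * n + n)) (qv ^ (2 * d)) k *
            qPoch (qv ^ (2 * (d : ℤ) - 2 - d * n + n) / av) (qv ^ (2 * d)) k *
            qPoch (qv ^ (d + 2)) (qv ^ (2 * d)) k)) *
        qv ^ (d * k)) = 0 := by
  obtain ⟨M, hM, hnat, hbound⟩ := exists_summation_bound hd2 hdeven hmod
  have hq := qv_ne_zero
  have hz : ∀ n : ℤ, (qv ^ d) ^ n = qv ^ ((d : ℤ) * n) := fun n => by
    rw [zpow_mul, zpow_natCast]
  have key := quadTerm_sum_eq_zero (p := qv ^ d) (b := av * qv) (c := qv / av) (e := ev) hM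
    (pow_ne_zero _ hq)
    (fun n => by
      have := zpow_mul_ne_zpow (i := (d * (n + 1) : ℕ)) (j := 0) (k := 0) (m := 0)
        (Or.inr (Or.inr (by positivity)))
      rw [← pow_succ', ← pow_mul]
      simpa only [zpow_natCast, zpow_zero, mul_one] using this)
    (mul_ne_zero av_ne_zero hq) (div_ne_zero hq av_ne_zero) ev_ne_zero
    (fun n => by
      rw [hz]
      simpa [mul_comm] using
        zpow_mul_ne_zpow (i := 1) (j := 1) (k := 0) (m := d * n) (by simp))
    (fun n => by
      rw [hz]
      simpa [div_eq_mul_inv] using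
        zpow_mul_ne_zpow (i := 1) (j := -1) (k := 0) (m := d * n) (by simp))
    (fun n => by
      rw [hz]
      simpa using zpow_mul_ne_zpow (i := 0) (j := 0) (k := 1) (m := d * n) (by simp))
    (fun n => by
      rw [hz]
      have := zpow_mul_ne_zpow (i := 2) (j := 2) (k := 0) (m := d * n) (by simp)
      rw [zpow_zero, mul_one] at this
      convert this using 1
      rw [mul_pow, mul_comm]
      norm_cast)
    (fun n => by
      rw [hz]
      have := zpow_mul_ne_zpow (i := 2) (j := -2) (k := 0) (m := d * n) (by simp)
      rw [zpow_zero, mul_one, zpow_neg] at this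
      convert this using 1
      rw [div_pow, div_eq_mul_inv]
      norm_cast)
    (fun n => by
      rw [hz]
      have := zpow_mul_ne_zpow (i := 0) (j := 2) (k := 0) (m := d * n) (by simp)
      rw [zpow_zero, zpow_zero, mul_one, one_mul] at this
      convert this using 1
      have := av_ne_zero
      field_simp)
    (fun n => by
      have := zpow_mul_ne_zpow (i := (2 + d + d * n : ℕ)) (j := 0) (k := 0) (m := 0)
        (Or.inr (Or.inr (by positivity)))
      rw [zpow_zero, zpow_zero, zpow_zero, zpow_natCast, mul_one, mul_one] at this
      convert this using 1
      have := av_ne_zero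
      rw [pow_add, pow_add, pow_mul]
      field_simp)
  have hrange : (d * n - n + 1) / (2 * d) = M := by
    rw [hnat, Nat.mul_div_cancel_left _ (by omega)]
  rw [hrange]
  have hA : (qv ^ d) ^ (-2 * M : ℤ) = qv ^ (-1 - (d : ℤ) * n + n) := by
    rw [hz]
    congr 1
    linarith
  rw [hA] at key
  rw [← mul_zero (1 - qv ^ (-1 - (d : ℤ) * n + n))⁻¹, ← key, mul_sum]
  refine sum_congr rfl fun k _ => ?_
  have x1 : qv ^ (3 * (d : ℤ) * k - 1 - d * n + n) =
      qv ^ (-1 - (d : ℤ) * n + n) * (qv ^ d) ^ (3 * k) := by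
    rw [← pow_mul, ← zpow_natCast, ← zpow_add₀ hq]
    congr 1
    push_cast
    ring
  have x2 : qv ^ ((d : ℤ) - 1 - d * n + n) = qv ^ (-1 - (d : ℤ) * n + n) * qv ^ d := by
    rw [← zpow_natCast, ← zpow_add₀ hq]
    congr 1
    ring
  have x3 : qv ^ ((d : ℤ) - 3 - d * n + n) =
      qv ^ (-1 - (d : ℤ) * n + n) * qv ^ d / (av * qv * (qv / av)) := by
    rw [show av * qv * (qv / av) = qv ^ (2 : ℤ) by
      have := av_ne_zero
      field_simp, ← zpow_natCast, ← zpow_add₀ hq, ← zpow_sub₀ hq]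
    congr 1
    ring
  have x4 : av * qv ^ (2 * (d : ℤ) - 2 - d * n + n) =
      qv ^ (-1 - (d : ℤ) * n + n) * (qv ^ d) ^ 2 / (qv / av) := by
    rw [show (2 * (d : ℤ) - 2 - d * n + n) = (-1 - (d : ℤ) * n + n) + (d * 2 : ℕ) - 1 by
      push_cast
      ring, zpow_sub₀ hq, zpow_add₀ hq, zpow_natCast, pow_mul, zpow_one]
    have := av_ne_zero
    field_simp
  have x5 : qv ^ (2 * (d : ℤ) - 2 - d * n + n) / av =
      qv ^ (-1 - (d : ℤ) * n + n) * (qv ^ d) ^ 2 / (av * qv) := by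
    rw [show (2 * (d : ℤ) - 2 - d * n + n) = (-1 - (d : ℤ) * n + n) + (d * 2 : ℕ) - 1 by
      push_cast
      ring, zpow_sub₀ hq, zpow_add₀ hq, zpow_natCast, pow_mul, zpow_one]
    have := av_ne_zero
    field_simp
  have x6 : qv ^ (d + 2) = av * qv * (qv / av) * qv ^ d := by
    have := av_ne_zero
    field_simp
    ring
  have x7 : qv ^ (2 * d) = (qv ^ d) ^ 2 := by rw [← pow_mul, mul_comm]
  rw [x1, x2, x3, x4, x5, x6, x7, pow_mul]
  simp only [quadTerm, fixedRatio, baseRatio, div_eq_mul_inv, mul_inv]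
  ring

end
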